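/- arXiv:1305.2767 — 4 statements merged into one kernel-verified Lean document; each statement's English description precedes it below -/
import Mathlib

section
/- Let K ≥ 1, σ² > 0, channel gains g₁, …, g_K > 0, and β ∈ (0, 1/(K−1)) (any β > 0 if K = 1). Suppose p ∈ ℝ^K has nonnegative entries and satisfies, for every i, p_i g_i = β·(Σ_{j ≠ i} p_j g_j + σ²) (i.e., every SINR equals β). Then necessarily p_i = (σ²/g_i) · β/(1 − (K−1)β) for all i; in particular the system of SINR equations has a unique solution. -/
open Finset in
/-- For `K ≥ 1` transmitters with positive channel gains `g i`, noise `σ² > 0`,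
and `β > 0` with `(K−1)β < 1` (any `β > 0` if `K = 1`), if a nonnegative power vector `p`
satisfies `pᵢ gᵢ = β (Σ_{j ≠ i} pⱼ gⱼ + σ²)` for every `i` (all SINRs equal `β`), then
necessarily `pᵢ = (σ²/gᵢ) · β/(1 − (K−1)β)` for all `i`. -/
theorem SINR_system_unique_solution (K : ℕ) (hK : 1 ≤ K) (σsq : ℝ) (hσ : 0 < σsq)
    (g : Fin K → ℝ) (hg : ∀ i, 0 < g i) (β : ℝ) (hβ : 0 < β)
    (hβK : ((K : ℝ) - 1) * β < 1)
    (p : Fin K → ℝ) (hpnn : ∀ i, 0 ≤ p i)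
    (hSINR : ∀ i, p i * g i = β * ((∑ j ∈ univ.erase i, p j * g j) + σsq)) :
    ∀ i, p i = (σsq / g i) * (β / (1 - ((K : ℝ) - 1) * β)) := by
  intro i
  have h : ∀ k, (p k * g k) * (1 + β) = β * ((∑ j, p j * g j) + σsq) := by
    intro k
    have h1 := hSINR k
    have h2 := Finset.add_sum_erase univ (fun j => p j * g j) (Finset.mem_univ k)
    rw [← h2]
    linarith
  have hb : (1 + β) ≠ 0 := by positivity
  have heq : ∀ k, p k * g k = p i * g i := fun k =>
    mul_right_cancel₀ hb ((h k).trans (h i).symm)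
  have hS : ∑ j, p j * g j = (K : ℝ) * (p i * g i) := by
    rw [Finset.sum_congr rfl (fun k _ => heq k)]
    simp
  have hi := h i
  rw [hS] at hi
  have hd : 1 - ((K : ℝ) - 1) * β ≠ 0 := by
    intro h0
    linarith
  have hgi : g i ≠ 0 := (hg i).ne'
  rw [div_mul_div_comm, eq_div_iff (mul_ne_zero hgi hd)]
  linarith
end

section
/- Let f : [0,∞) → ℝ be continuously differentiable with f(0) = 0, nondecreasing, bounded above, twice differentiable on (0,∞), and suppose there exists x₀ > 0 such that f''(x) > 0 for 0 < x < x₀ and f''(x) < 0 for x > x₀ (f is sigmoidal). Then the equation x f'(x) − f(x) = 0 has a unique solution β* in (0,∞), and β* > x₀. -/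
/-- Let `f` be a sigmoidal packet success rate function: continuously
differentiable on `[0,∞)` with `f 0 = 0`, nondecreasing, bounded above, twice
differentiable on `(0,∞)`, with `f'' > 0` on `(0, x₀)` and `f'' < 0` on `(x₀, ∞)`.
Then `x f'(x) − f(x) = 0` has a unique solution `β*` in `(0,∞)`, and `β* > x₀`. -/
theorem sigmoidal_unique_equilibrium_SINR (f : ℝ → ℝ) (x₀ : ℝ) (hx₀ : 0 < x₀)
    (hf0 : f 0 = 0)
    (hC1 : ContDiffOn ℝ 1 f (Set.Ici 0))
    (hmono : MonotoneOn f (Set.Ici 0))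
    (hbdd : BddAbove (f '' Set.Ici 0))
    (hdiff2 : ∀ x : ℝ, 0 < x → DifferentiableAt ℝ (deriv f) x)
    (hconv : ∀ x : ℝ, 0 < x → x < x₀ → 0 < deriv (deriv f) x)
    (hconc : ∀ x : ℝ, x₀ < x → deriv (deriv f) x < 0) :
    (∃! β : ℝ, 0 < β ∧ β * deriv f β - f β = 0) ∧
    (∀ β : ℝ, 0 < β → β * deriv f β - f β = 0 → x₀ < β) := by
  have hd : ∀ x : ℝ, 0 < x → DifferentiableAt ℝ f x := fun x hx =>
    (hC1.differentiableOn (by norm_num)).differentiableAt (Ici_mem_nhds hx)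
  have hg : ∀ x : ℝ, 0 < x →
      HasDerivAt (fun x => x * deriv f x - f x) (x * deriv (deriv f) x) x := by
    intro x hx
    have h := ((hasDerivAt_id x).mul (hdiff2 x hx).hasDerivAt).sub (hd x hx).hasDerivAt
    refine h.congr_deriv ?_
    simp
  have hgc : ∀ x : ℝ, 0 < x → ContinuousAt (fun x => x * deriv f x - f x) x :=
    fun x hx => (hg x hx).continuousAt
  -- the derivative is strictly increasing on (0, x₀]
  have hmonoD : StrictMonoOn (deriv f) (Set.Ioc 0 x₀) := by
    apply strictMonoOn_of_deriv_pos (convex_Ioc 0 x₀)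
    · intro x hx
      exact (hdiff2 x hx.1).continuousAt.continuousWithinAt
    · intro x hx
      rw [interior_Ioc] at hx
      exact hconv x hx.1 hx.2
  -- the function is strictly decreasing on [x₀, ∞)
  have hanti : StrictAntiOn (fun x => x * deriv f x - f x) (Set.Ici x₀) := by
    apply strictAntiOn_of_deriv_neg (convex_Ici x₀)
    · intro x hx
      exact (hgc x (lt_of_lt_of_le hx₀ hx)).continuousWithinAt
    · intro x hx
      rw [interior_Ici] at hx
      have hx' : x₀ < x := hx
      have h0 : 0 < x := hx₀.trans hx'
      rw [(hg x h0).deriv]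
      exact mul_neg_of_pos_of_neg h0 (hconc x hx')
  have hmvt : ∀ x : ℝ, 0 < x → ∃ c, 0 < c ∧ c < x ∧ f x = x * deriv f c := by
    intro x hx
    obtain ⟨c, hc, h⟩ := exists_deriv_eq_slope f hx
      (hC1.continuousOn.mono Set.Icc_subset_Ici_self)
      (fun y hy => (hd y hy.1).differentiableWithinAt)
    refine ⟨c, hc.1, hc.2, ?_⟩
    rw [h, hf0, sub_zero, sub_zero, mul_div_cancel₀ _ hx.ne']
  have hpos : ∀ x : ℝ, 0 < x → x ≤ x₀ → 0 < x * deriv f x - f x := by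
    intro x hx hxx
    obtain ⟨c, hc, hcx, h⟩ := hmvt x hx
    have h1 := hmonoD ⟨hc, hcx.le.trans hxx⟩ ⟨hx, hxx⟩ hcx
    rw [h]
    nlinarith
  have hf0' : ∀ x : ℝ, 0 ≤ x → 0 ≤ f x := by
    intro x hx
    have := hmono (Set.mem_Ici.2 le_rfl) (Set.mem_Ici.2 hx) hx
    rwa [hf0] at this
  have hfx : 0 < f x₀ := by
    obtain ⟨c, hc, hcx, h⟩ := hmvt x₀ hx₀
    have h1 := hpos c hc hcx.le
    have h2 := hf0' c hc.le
    have h3 : 0 < deriv f c := by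
      by_contra hn
      have := mul_nonneg hc.le (neg_nonneg.2 (not_lt.1 hn))
      linarith
    rw [h]
    exact mul_pos hx₀ h3
  -- a point where the function is negative
  have hneg : ∃ c, x₀ < c ∧ c * deriv f c - f c < 0 := by
    obtain ⟨M, hM⟩ := hbdd
    have hM' : ∀ x : ℝ, 0 ≤ x → f x ≤ M := fun x hx => hM ⟨x, hx, rfl⟩
    have hM0 : 0 < M := hfx.trans_le (hM' x₀ hx₀.le)
    obtain ⟨y, hy⟩ : ∃ y, y = x₀ + x₀ * M / f x₀ := ⟨_, rfl⟩
    have hxy : x₀ < y := by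
      have : 0 < x₀ * M / f x₀ := by positivity
      linarith
    have hy0 : 0 < y := hx₀.trans hxy
    have hder : ∀ x : ℝ, 0 < x →
        HasDerivAt (fun x => f x / x) ((x * deriv f x - f x) / x ^ 2) x := by
      intro x hx
      have h := (hd x hx).hasDerivAt.div (hasDerivAt_id x) hx.ne'
      refine h.congr_deriv ?_
      simp [mul_comm]
    obtain ⟨c, hc, h⟩ := exists_hasDerivAt_eq_slope (fun x => f x / x)
      (fun x => (x * deriv f x - f x) / x ^ 2) hxy
      (fun x hx => (hder x (hx₀.trans_le hx.1)).continuousAt.continuousWithinAt)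
      (fun x hx => hder x (hx₀.trans hx.1))
    refine ⟨c, hc.1, ?_⟩
    have hlt : f y / y < f x₀ / x₀ := by
      rw [div_lt_div_iff₀ hy0 hx₀]
      have h1 : f x₀ * y = f x₀ * x₀ + x₀ * M := by
        rw [hy]; field_simp
      have h2 := mul_le_mul_of_nonneg_right (hM' y hy0.le) hx₀.le
      have h3 := mul_pos hfx hx₀
      linarith
    have h4 : (c * deriv f c - f c) / c ^ 2 < 0 := by
      have h' : (c * deriv f c - f c) / c ^ 2 = (f y / y - f x₀ / x₀) / (y - x₀) := h
      rw [h']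
      exact div_neg_of_neg_of_pos (by linarith) (by linarith)
    by_contra hn
    have := div_nonneg (not_lt.1 hn) (sq_nonneg c)
    linarith
  have hgt : ∀ β : ℝ, 0 < β → β * deriv f β - f β = 0 → x₀ < β := by
    intro β hβ h
    by_contra hn
    have := hpos β hβ (not_lt.1 hn)
    linarith
  refine ⟨?_, hgt⟩
  obtain ⟨c, hc, hcn⟩ := hneg
  obtain ⟨β, hβ, hβ0⟩ := intermediate_value_Icc' hc.le
    (f := fun x => x * deriv f x - f x)
    (fun x hx => (hgc x (hx₀.trans_le hx.1)).continuousWithinAt)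
    (show (0 : ℝ) ∈ _ from ⟨hcn.le, (hpos x₀ hx₀ le_rfl).le⟩)
  refine ⟨β, ⟨hx₀.trans_le hβ.1, hβ0⟩, ?_⟩
  rintro z ⟨hz, hz0⟩
  exact hanti.injOn (Set.mem_Ici.2 (hgt z hz hz0).le) (Set.mem_Ici.2 hβ.1) (hz0.trans hβ0.symm)
end

section
/- Let f : [0,∞) → ℝ be continuously differentiable with f(0) = 0, nondecreasing, bounded above, twice differentiable on (0,∞), convex on (0,x₀) and concave on (x₀,∞) for some x₀ > 0, and let β* be the unique positive solution of x f'(x) − f(x) = 0. Then x f'(x) − f(x) > 0 for all x ∈ (0, β*) and x f'(x) − f(x) < 0 for all x ∈ (β*, ∞). -/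
/-- Let `f` be a sigmoidal packet success rate function (continuously
differentiable on `[0,∞)` with `f 0 = 0`, nondecreasing, bounded above, twice
differentiable on `(0,∞)`, convex on `(0, x₀)` and concave on `(x₀, ∞)`), and let `β*`
be the unique positive solution of `x f'(x) − f(x) = 0`. Then `x f'(x) − f(x) > 0` on
`(0, β*)` and `x f'(x) − f(x) < 0` on `(β*, ∞)`. -/
theorem sigmoidal_sign_of_xf'_minus_f (f : ℝ → ℝ) (x₀ : ℝ) (hx₀ : 0 < x₀)
    (hf0 : f 0 = 0)
    (hC1 : ContDiffOn ℝ 1 f (Set.Ici 0))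
    (hmono : MonotoneOn f (Set.Ici 0))
    (hbdd : BddAbove (f '' Set.Ici 0))
    (hdiff2 : ∀ x : ℝ, 0 < x → DifferentiableAt ℝ (deriv f) x)
    (hconvex : ConvexOn ℝ (Set.Ioo 0 x₀) f)
    (hconcave : ConcaveOn ℝ (Set.Ioi x₀) f)
    (βstar : ℝ) (hβpos : 0 < βstar)
    (hβsol : βstar * deriv f βstar - f βstar = 0)
    (hβuniq : ∀ x : ℝ, 0 < x → x * deriv f x - f x = 0 → x = βstar) :
    (∀ x : ℝ, 0 < x → x < βstar → 0 < x * deriv f x - f x) ∧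
    (∀ x : ℝ, βstar < x → x * deriv f x - f x < 0) := by
  have hd : ∀ x : ℝ, 0 < x → DifferentiableAt ℝ f x := fun x hx =>
    ((hC1.differentiableOn (by norm_num)) x hx.le).differentiableAt (Ici_mem_nhds hx)
  have hcont : ContinuousOn f (Set.Ici 0) := hC1.continuousOn
  have hm : MonotoneOn (deriv f) (Set.Ioo 0 x₀) :=
    hconvex.monotoneOn_deriv (fun x hx => hd x hx.1)
  have ha : AntitoneOn (deriv f) (Set.Ioi x₀) :=
    hconcave.antitoneOn_deriv (fun x hx => hd x (hx₀.trans hx))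
  have mvt : ∀ a b : ℝ, 0 ≤ a → a < b → ∃ c ∈ Set.Ioo a b, f b - f a = (b - a) * deriv f c := by
    intro a b h0 hab
    obtain ⟨c, hc, h⟩ := exists_deriv_eq_slope f hab
      (hcont.mono (fun x hx => h0.trans hx.1))
      (fun x hx => (hd x (h0.trans_lt hx.1)).differentiableWithinAt)
    refine ⟨c, hc, ?_⟩
    have : b - a ≠ 0 := by linarith
    rw [h]; field_simp
  have gm : ∀ a b : ℝ, 0 < a → a < b → b < x₀ →
      a * deriv f a - f a ≤ b * deriv f b - f b := by
    intro a b h0 hab hb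
    obtain ⟨c, hc, h⟩ := mvt a b h0.le hab
    have h1 := hm ⟨h0, by linarith⟩ ⟨h0.trans hc.1, hc.2.trans hb⟩ hc.1.le
    have h2 := hm ⟨h0.trans hc.1, hc.2.trans hb⟩ ⟨h0.trans hab, hb⟩ hc.2.le
    have h3 := mul_le_mul_of_nonneg_left h1 h0.le
    have h4 := mul_le_mul_of_nonneg_left h2 (h0.trans hab).le
    linarith
  have ga : ∀ a b : ℝ, x₀ < a → a < b →
      b * deriv f b - f b ≤ a * deriv f a - f a := by
    intro a b h0 hab
    have ha0 : 0 < a := hx₀.trans h0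
    obtain ⟨c, hc, h⟩ := mvt a b ha0.le hab
    have h1 := ha (show a ∈ Set.Ioi x₀ from h0) (show c ∈ Set.Ioi x₀ from h0.trans hc.1) hc.1.le
    have h2 := ha (show c ∈ Set.Ioi x₀ from h0.trans hc.1)
      (show b ∈ Set.Ioi x₀ from h0.trans hab) hc.2.le
    have h3 := mul_le_mul_of_nonneg_left h1 ha0.le
    have h4 := mul_le_mul_of_nonneg_left h2 (ha0.trans hab).le
    linarith
  have gnn : ∀ x : ℝ, 0 < x → x < x₀ → 0 ≤ x * deriv f x - f x := by
    intro x h0 hx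
    obtain ⟨c, hc, h⟩ := mvt 0 x le_rfl h0
    have h1 := hm ⟨hc.1, hc.2.trans hx⟩ ⟨h0, hx⟩ hc.2.le
    have h3 := mul_le_mul_of_nonneg_left h1 h0.le
    rw [hf0] at h
    linarith
  have gx0 : ∀ a : ℝ, 0 < a → a < x₀ → a * deriv f a - f a ≤ x₀ * deriv f x₀ - f x₀ := by
    intro a h0 hax
    have hc : ContinuousAt (fun x => x * deriv f x - f x) x₀ :=
      (continuousAt_id.mul (hdiff2 x₀ hx₀).continuousAt).sub (hd x₀ hx₀).continuousAt
    refine ge_of_tendsto (hc.tendsto.mono_left (nhdsWithin_le_nhds (s := Set.Iio x₀))) ?_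
    filter_upwards [Ioo_mem_nhdsLT hax] with b hb
    exact gm a b h0 hb.1 hb.2
  have gmle : ∀ a b : ℝ, 0 < a → a < b → b ≤ x₀ →
      a * deriv f a - f a ≤ b * deriv f b - f b := by
    intro a b h0 hab hb
    rcases hb.lt_or_eq with h | h
    · exact gm a b h0 hab h
    · subst h; exact gx0 a h0 hab
  have gnnle : ∀ x : ℝ, 0 < x → x ≤ x₀ → 0 ≤ x * deriv f x - f x := by
    intro x h0 hx
    exact (gnn (x / 2) (by linarith) (by linarith)).trans
      (gmle (x / 2) x (by linarith) (by linarith) hx)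
  have hβ : x₀ < βstar := by
    by_contra! hle
    have h1 := gnn (βstar / 2) (by linarith) (by linarith)
    have h2 := gmle (βstar / 2) βstar (by linarith) (by linarith) hle
    have h3 := hβuniq (βstar / 2) (by linarith) (by linarith)
    linarith
  constructor
  · intro x h0 hx
    refine lt_of_le_of_ne ?_ (fun h => hx.ne (hβuniq x h0 h.symm))
    rcases le_or_gt x x₀ with h | h
    · exact gnnle x h0 h
    · exact hβsol.symm.le.trans (ga x βstar h hx)
  · intro x hx
    exact lt_of_le_of_ne ((ga βstar x hβ hx).trans hβsol.le)
      (fun h => hx.ne' (hβuniq x (hβpos.trans hx) h))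
end

section
/- Let f : [0,∞) → ℝ be continuously differentiable with f(0) = 0, nondecreasing, bounded above, twice differentiable on (0,∞), convex on (0,x₀) and concave on (x₀,∞) for some x₀ > 0, let β* be the unique positive solution of x f'(x) − f(x) = 0, and let c > 0. Then the function u(p) = f(cp)/p is strictly increasing on (0, β*/c) and strictly decreasing on (β*/c, ∞); in particular, p* = β*/c is the unique global maximizer of u on (0,∞) and u is quasi-concave. -/
/-- Let `f` be a sigmoidal packet success rate function (continuously
differentiable on `[0,∞)` with `f 0 = 0`, nondecreasing, bounded above, twice
differentiable on `(0,∞)`, convex on `(0, x₀)` and concave on `(x₀, ∞)`), let `β*` be the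
unique positive solution of `x f'(x) − f(x) = 0`, and let `c > 0`. Then `u(p) = f(cp)/p`
is strictly increasing on `(0, β*/c)` and strictly decreasing on `(β*/c, ∞)`; in
particular `β*/c` is the unique global maximizer of `u` on `(0,∞)`, and `u` is
quasi-concave on `(0,∞)`. -/
theorem energy_efficiency_unimodal (f : ℝ → ℝ) (x₀ : ℝ) (hx₀ : 0 < x₀)
    (hf0 : f 0 = 0)
    (hC1 : ContDiffOn ℝ 1 f (Set.Ici 0))
    (hmono : MonotoneOn f (Set.Ici 0))
    (hbdd : BddAbove (f '' Set.Ici 0))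
    (hdiff2 : ∀ x : ℝ, 0 < x → DifferentiableAt ℝ (deriv f) x)
    (hconvex : ConvexOn ℝ (Set.Ioo 0 x₀) f)
    (hconcave : ConcaveOn ℝ (Set.Ioi x₀) f)
    (βstar : ℝ) (hβpos : 0 < βstar)
    (hβsol : βstar * deriv f βstar - f βstar = 0)
    (hβuniq : ∀ x : ℝ, 0 < x → x * deriv f x - f x = 0 → x = βstar)
    (c : ℝ) (hc : 0 < c) :
    StrictMonoOn (fun p : ℝ => f (c * p) / p) (Set.Ioo 0 (βstar / c)) ∧
    StrictAntiOn (fun p : ℝ => f (c * p) / p) (Set.Ioi (βstar / c)) ∧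
    (∀ p : ℝ, 0 < p → p ≠ βstar / c →
      f (c * p) / p < f (c * (βstar / c)) / (βstar / c)) ∧
    QuasiconcaveOn ℝ (Set.Ioi 0) (fun p : ℝ => f (c * p) / p) := by
  have hd : ∀ x : ℝ, 0 < x → DifferentiableAt ℝ f x := fun x hx =>
    (hC1.differentiableOn (by norm_num)).differentiableAt (Ici_mem_nhds hx)
  have hcont : ContinuousOn f (Set.Ici 0) := hC1.continuousOn
  have hdc : ∀ x : ℝ, 0 < x → ContinuousAt (deriv f) x := fun x hx => (hdiff2 x hx).continuousAt
  have mvt : ∀ a b : ℝ, 0 ≤ a → a < b → ∃ ξ, a < ξ ∧ ξ < b ∧ f b - f a = (b - a) * deriv f ξ := by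
    intro a b ha hab
    obtain ⟨ξ, hξ, h⟩ := exists_deriv_eq_slope f hab
      (hcont.mono (fun x hx => le_trans ha hx.1))
      (fun x hx => (hd x (lt_of_le_of_lt ha hx.1)).differentiableWithinAt)
    refine ⟨ξ, hξ.1, hξ.2, ?_⟩
    have : b - a ≠ 0 := (sub_pos.2 hab).ne'
    rw [h]; field_simp
  have m1 : MonotoneOn (deriv f) (Set.Ioo 0 x₀) :=
    hconvex.monotoneOn_deriv (fun x hx => hd x hx.1)
  have m2 : AntitoneOn (deriv f) (Set.Ioi x₀) :=
    hconcave.antitoneOn_deriv (fun x hx => hd x (hx₀.trans hx))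
  have M1 : ∀ a b : ℝ, 0 < a → a ≤ b → b ≤ x₀ → deriv f a ≤ deriv f b := by
    intro a b ha hab hb
    rcases hb.lt_or_eq with hb | rfl
    · exact m1 ⟨ha, hab.trans_lt hb⟩ ⟨ha.trans_le hab, hb⟩ hab
    · rcases hab.lt_or_eq with hab | rfl
      · refine ge_of_tendsto ((hdc b hx₀).tendsto.mono_left
          (nhdsWithin_le_nhds : nhdsWithin b (Set.Iio b) ≤ nhds b)) ?_
        filter_upwards [Ioo_mem_nhdsLT hab] with y hy
        exact m1 ⟨ha, hab⟩ ⟨ha.trans hy.1, hy.2⟩ hy.1.le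
      · exact le_rfl
  have M2 : ∀ a b : ℝ, x₀ ≤ a → a ≤ b → deriv f b ≤ deriv f a := by
    intro a b ha hab
    rcases ha.lt_or_eq with ha | rfl
    · exact m2 ha (ha.trans_le hab) hab
    · rcases hab.lt_or_eq with hab | rfl
      · refine ge_of_tendsto ((hdc x₀ hx₀).tendsto.mono_left
          (nhdsWithin_le_nhds : nhdsWithin x₀ (Set.Ioi x₀) ≤ nhds x₀)) ?_
        filter_upwards [Ioo_mem_nhdsGT hab] with y hy
        exact m2 hy.1 hab hy.2.le
      · exact le_rfl
  have hβx : x₀ < βstar := by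
    by_contra hle
    push Not at hle
    obtain ⟨ξ, h1, h2, h3⟩ := mvt 0 βstar le_rfl hβpos
    obtain ⟨η, h4, h5, h6⟩ := mvt ξ βstar h1.le h2
    have e1 : deriv f ξ = deriv f βstar := by
      have : βstar * deriv f ξ = βstar * deriv f βstar := by linarith
      exact mul_left_cancel₀ hβpos.ne' this
    have e2 : deriv f η = deriv f βstar := by
      have := M1 ξ η h1 h4.le (h5.le.trans hle)
      have := M1 η βstar (h1.trans h4) h5.le hle
      linarith
    rw [e2] at h6
    have := hβuniq ξ h1 (by rw [e1]; linarith)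
    linarith
  have hH : ∀ x y : ℝ, x₀ ≤ x → x < y → y * deriv f y - f y ≤ x * deriv f x - f x := by
    intro x y hx hxy
    obtain ⟨ξ, h1, h2, h3⟩ := mvt x y (hx₀.le.trans hx) hxy
    have i1 := M2 ξ y (hx.trans h1.le) h2.le
    have i2 := M2 x y hx hxy.le
    nlinarith [mul_nonneg (sub_pos.2 hxy).le (sub_nonneg.2 i1),
      mul_nonneg (hx₀.le.trans hx) (sub_nonneg.2 i2)]
  have hpos : ∀ x : ℝ, 0 < x → x < βstar → 0 < x * deriv f x - f x := by
    intro x hx hxb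
    refine lt_of_le_of_ne ?_ (fun h => hxb.ne (hβuniq x hx h.symm))
    rcases le_total x₀ x with h | h
    · have := hH x βstar h hxb
      linarith
    · obtain ⟨ξ, h1, h2, h3⟩ := mvt 0 x le_rfl hx
      have := mul_le_mul_of_nonneg_left (M1 ξ x h1 h2.le h) hx.le
      linarith
  have hneg : ∀ x : ℝ, βstar < x → x * deriv f x - f x < 0 := by
    intro x hx
    refine lt_of_le_of_ne ?_ (fun h => hx.ne' (hβuniq x (hβpos.trans hx) h))
    have := hH βstar x hβx.le hx
    linarith
  have hder : ∀ x : ℝ, 0 < x →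
      HasDerivAt (fun x => f x / x) ((x * deriv f x - f x) / x ^ 2) x := by
    intro x hx
    have := (hd x hx).hasDerivAt.fun_div (hasDerivAt_id' x) hx.ne'
    have e : (x * deriv f x - f x) / x ^ 2 = (deriv f x * x - f x * 1) / x ^ 2 := by ring
    rw [e]
    exact this
  have S1 : StrictMonoOn (fun x => f x / x) (Set.Ioc 0 βstar) := by
    refine strictMonoOn_of_deriv_pos (convex_Ioc _ _)
      (fun x hx => (hder x hx.1).continuousAt.continuousWithinAt) ?_
    intro x hx
    rw [interior_Ioc] at hx
    rw [(hder x hx.1).deriv]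
    exact div_pos (hpos x hx.1 hx.2) (pow_pos hx.1 2)
  have S2 : StrictAntiOn (fun x => f x / x) (Set.Ici βstar) := by
    refine strictAntiOn_of_deriv_neg (convex_Ici _)
      (fun x hx => (hder x (hβpos.trans_le hx)).continuousAt.continuousWithinAt) ?_
    intro x hx
    rw [interior_Ici] at hx
    rw [(hder x (hβpos.trans hx)).deriv]
    exact div_neg_of_neg_of_pos (hneg x hx) (pow_pos (hβpos.trans hx) 2)
  have hu : ∀ p : ℝ, f (c * p) / p = c * (f (c * p) / (c * p)) := by
    intro p
    rw [← mul_div_assoc, mul_div_mul_left _ _ hc.ne']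
  have T1 : StrictMonoOn (fun p : ℝ => f (c * p) / p) (Set.Ioc 0 (βstar / c)) := by
    intro x hx y hy hxy
    show f (c * x) / x < f (c * y) / y
    rw [hu x, hu y]
    have hx' := (le_div_iff₀' hc).1 hx.2
    have hy' := (le_div_iff₀' hc).1 hy.2
    exact mul_lt_mul_of_pos_left (S1 ⟨mul_pos hc hx.1, hx'⟩ ⟨mul_pos hc hy.1, hy'⟩
      (mul_lt_mul_of_pos_left hxy hc)) hc
  have T2 : StrictAntiOn (fun p : ℝ => f (c * p) / p) (Set.Ici (βstar / c)) := by
    intro x hx y hy hxy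
    show f (c * y) / y < f (c * x) / x
    rw [hu x, hu y]
    have hx' := (div_le_iff₀' hc).1 hx
    have hy' := (div_le_iff₀' hc).1 hy
    exact mul_lt_mul_of_pos_left (S2 hx' hy' (mul_lt_mul_of_pos_left hxy hc)) hc
  have hq : 0 < βstar / c := div_pos hβpos hc
  refine ⟨T1.mono Set.Ioo_subset_Ioc_self, T2.mono Set.Ioi_subset_Ici_self, ?_, ?_⟩
  · intro p hp hne
    rcases lt_or_gt_of_ne hne with h | h
    · exact T1 ⟨hp, h.le⟩ ⟨hq, le_rfl⟩ h
    · exact T2 (Set.mem_Ici.2 le_rfl) (Set.mem_Ici.2 h.le) h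
  · intro r
    apply Set.OrdConnected.convex
    refine ⟨fun x hx y hy z hz => ?_⟩
    have hx0 : 0 < x := hx.1
    have hz0 : 0 < z := hx0.trans_le hz.1
    refine ⟨hz0, ?_⟩
    rcases le_total z (βstar / c) with h | h
    · exact le_trans hx.2 (T1.monotoneOn ⟨hx0, hz.1.trans h⟩ ⟨hz0, h⟩ hz.1)
    · exact le_trans hy.2 (T2.antitoneOn (Set.mem_Ici.2 h) (Set.mem_Ici.2 (h.trans hz.2)) hz.2)
end
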